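/- Let R be an associative ring with unit and let (A, B) be a hereditary complete cotorsion pair in Mod R with kernel ω = A ∩ B and pd_A(A) < ∞. Then: (c) pd M ≤ pd_A(A) + resdim_A(M) for every M in the class P of modules of finite projective dimension; and (d) P ∩ B = ω^∧. -/

import Mathlib

noncomputable section

open CategoryTheory CategoryTheory.Limits Opposite DirectSum

universe u

namespace CotorsionDim

variable {R : Type u} [Ring R]

/-- `Ext^n_R(M,N) = 0`. -/
def ExtZero (M N : ModuleCat.{u} R) (n : ℕ) : Prop :=
  IsZero (((Ext ℤ (ModuleCat.{u} R) n).obj (op M)).obj N)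

/-- A pair of composable maps forms a short exact sequence `0 → A → B → C → 0`. -/
def IsSES {A B C : ModuleCat.{u} R} (f : A ⟶ B) (g : B ⟶ C) : Prop :=
  ∃ w : f ≫ g = 0, (CategoryTheory.ShortComplex.mk f g w).ShortExact

/-- relative projective dimension `pd_𝒳(M)` -/
def rpd (𝒳 : Set (ModuleCat.{u} R)) (M : ModuleCat.{u} R) : ℕ∞ :=
  sInf {n : ℕ∞ | ∀ j : ℕ, n < (j : ℕ∞) → ∀ X ∈ 𝒳, ExtZero M X j}

/-- relative injective dimension `id_𝒳(M)` -/
def rid (𝒳 : Set (ModuleCat.{u} R)) (M : ModuleCat.{u} R) : ℕ∞ :=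
  sInf {n : ℕ∞ | ∀ j : ℕ, n < (j : ℕ∞) → ∀ X ∈ 𝒳, ExtZero X M j}

/-- `pd_𝒳(𝒴)` -/
def rpdClass (𝒳 𝒴 : Set (ModuleCat.{u} R)) : ℕ∞ := ⨆ Y : 𝒴, rpd 𝒳 Y

/-- `id_𝒳(𝒴)` -/
def ridClass (𝒳 𝒴 : Set (ModuleCat.{u} R)) : ℕ∞ := ⨆ Y : 𝒴, rid 𝒳 Y

/-- projective dimension -/
def pd (M : ModuleCat.{u} R) : ℕ∞ := rpd Set.univ M

/-- injective dimension -/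
def idim (M : ModuleCat.{u} R) : ℕ∞ := rid Set.univ M

/-- `pd(𝒴)` -/
def pdClass (𝒴 : Set (ModuleCat.{u} R)) : ℕ∞ := ⨆ Y : 𝒴, pd Y.1

/-- `id(𝒴)` -/
def idClass (𝒴 : Set (ModuleCat.{u} R)) : ℕ∞ := ⨆ Y : 𝒴, idim Y.1

/-- `M` has an `𝒳`-resolution `0 → X_n → ⋯ → X_0 → M → 0` of length `n`. -/
def HasResLen (𝒳 : Set (ModuleCat.{u} R)) : ℕ → ModuleCat.{u} R → Prop
  | 0, M => M ∈ 𝒳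
  | n+1, M => ∃ (K X : ModuleCat.{u} R) (f : K ⟶ X) (g : X ⟶ M),
      X ∈ 𝒳 ∧ IsSES f g ∧ HasResLen 𝒳 n K

/-- `M` has an `𝒳`-coresolution `0 → M → X_0 → ⋯ → X_n → 0` of length `n`. -/
def HasCoresLen (𝒳 : Set (ModuleCat.{u} R)) : ℕ → ModuleCat.{u} R → Prop
  | 0, M => M ∈ 𝒳
  | n+1, M => ∃ (X C : ModuleCat.{u} R) (f : M ⟶ X) (g : X ⟶ C),
      X ∈ 𝒳 ∧ IsSES f g ∧ HasCoresLen 𝒳 n C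

/-- `resdim_𝒳(M)` -/
def resdim (𝒳 : Set (ModuleCat.{u} R)) (M : ModuleCat.{u} R) : ℕ∞ :=
  ⨅ n : {n : ℕ // HasResLen 𝒳 n M}, (n : ℕ∞)

/-- `coresdim_𝒳(M)` -/
def coresdim (𝒳 : Set (ModuleCat.{u} R)) (M : ModuleCat.{u} R) : ℕ∞ :=
  ⨅ n : {n : ℕ // HasCoresLen 𝒳 n M}, (n : ℕ∞)

/-- `resdim_𝒳(𝒴)` -/
def resdimClass (𝒳 𝒴 : Set (ModuleCat.{u} R)) : ℕ∞ := ⨆ Y : 𝒴, resdim 𝒳 Y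

/-- `coresdim_𝒳(𝒴)` -/
def coresdimClass (𝒳 𝒴 : Set (ModuleCat.{u} R)) : ℕ∞ := ⨆ Y : 𝒴, coresdim 𝒳 Y

/-- `𝒳^∧`, the class of modules with a finite `𝒳`-resolution. -/
def resClosure (𝒳 : Set (ModuleCat.{u} R)) : Set (ModuleCat.{u} R) :=
  {M | ∃ n, HasResLen 𝒳 n M}

/-- `𝒳^∨`, the class of modules with a finite `𝒳`-coresolution. -/
def coresClosure (𝒳 : Set (ModuleCat.{u} R)) : Set (ModuleCat.{u} R) :=
  {M | ∃ n, HasCoresLen 𝒳 n M}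

/-- `(𝒜, ℬ)` is a cotorsion pair. -/
def IsCotorsionPair (𝒜 ℬ : Set (ModuleCat.{u} R)) : Prop :=
  (∀ M, M ∈ 𝒜 ↔ ∀ B ∈ ℬ, ExtZero M B 1) ∧
  (∀ M, M ∈ ℬ ↔ ∀ A ∈ 𝒜, ExtZero A M 1)

/-- completeness of a cotorsion pair -/
def IsComplete (𝒜 ℬ : Set (ModuleCat.{u} R)) : Prop :=
  ∀ M : ModuleCat.{u} R,
    (∃ (B A : ModuleCat.{u} R) (f : B ⟶ A) (g : A ⟶ M), B ∈ ℬ ∧ A ∈ 𝒜 ∧ IsSES f g) ∧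
    (∃ (B A : ModuleCat.{u} R) (f : M ⟶ B) (g : B ⟶ A), B ∈ ℬ ∧ A ∈ 𝒜 ∧ IsSES f g)

/-- heredity of a cotorsion pair -/
def IsHereditary (𝒜 ℬ : Set (ModuleCat.{u} R)) : Prop :=
  ∀ i : ℕ, 1 ≤ i → ∀ A ∈ 𝒜, ∀ B ∈ ℬ, ExtZero A B i

variable (R)

/-- `𝒫`, the class of modules of finite projective dimension. -/
def P : Set (ModuleCat.{u} R) := {M | pd M < ⊤}

variable {R}

/-- `M` admits a projective resolution consisting of finitely generated projectives,
i.e. `M ∈ mod R`. -/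
def InmodR (M : ModuleCat.{u} R) : Prop :=
  ∃ K : ℕ → ModuleCat.{u} R, K 0 = M ∧ ∀ i : ℕ,
    ∃ (Q : ModuleCat.{u} R) (f : K (i+1) ⟶ Q) (g : Q ⟶ K i),
      Module.Finite R Q ∧ Projective Q ∧ IsSES f g

variable (R)

/-- `𝒫^{<∞} = 𝒫 ∩ mod R`. -/
def Pfin : Set (ModuleCat.{u} R) := {M | pd M < ⊤ ∧ InmodR M}

/-- the big finitistic dimension -/
def bigFindim : ℕ∞ := pdClass (P R)

/-- the little finitistic dimension -/
def littleFindim : ℕ∞ := pdClass (Pfin R)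

variable {R}

/-- `𝒳^{⊥₁}` -/
def rperp1 (𝒳 : Set (ModuleCat.{u} R)) : Set (ModuleCat.{u} R) :=
  {M | ∀ X ∈ 𝒳, ExtZero X M 1}

/-- `^{⊥₁}𝒳` -/
def lperp1 (𝒳 : Set (ModuleCat.{u} R)) : Set (ModuleCat.{u} R) :=
  {M | ∀ X ∈ 𝒳, ExtZero M X 1}

/-- `T^⊥ = {M : Ext^i(T,M) = 0 for all i > 0}` -/
def rperpAll (T : ModuleCat.{u} R) : Set (ModuleCat.{u} R) :=
  {M | ∀ i : ℕ, 0 < i → ExtZero T M i}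

/-- `Add T`: direct summands of arbitrary direct sums of copies of `T`. -/
def AddT (T : ModuleCat.{u} R) : Set (ModuleCat.{u} R) :=
  {M | ∃ (I : Type u) (s : M ⟶ ModuleCat.of R (I →₀ T)) (r : ModuleCat.of R (I →₀ T) ⟶ M),
    s ≫ r = 𝟙 M}

/-- `T` is a tilting module. -/
def IsTilting (T : ModuleCat.{u} R) : Prop :=
  pd T < ⊤ ∧
  (∀ i : ℕ, 0 < i → ∀ I : Type u, ExtZero T (ModuleCat.of R (I →₀ T)) i) ∧
  ∃ n, HasCoresLen (AddT T) n (ModuleCat.of R R)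


/-- `𝒳` is closed under arbitrary direct sums (coproducts). -/
def ClosedUnderCoproducts (𝒳 : Set (ModuleCat.{u} R)) : Prop :=
  ∀ (I : Type u) (f : I → ModuleCat.{u} R), (∀ i, f i ∈ 𝒳) →
    ModuleCat.of R (⨁ i, (f i : Type u)) ∈ 𝒳

/-- `𝒳` is closed under direct summands. -/
def ClosedUnderSummands (𝒳 : Set (ModuleCat.{u} R)) : Prop :=
  ∀ (M N : ModuleCat.{u} R) (s : M ⟶ N) (r : N ⟶ M), s ≫ r = 𝟙 M → N ∈ 𝒳 → M ∈ 𝒳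

/-- In positive degree, the vanishing of the derived-functor `Ext` agrees with that of the
`Ext` defined through the derived category. -/
lemma extZero_succ_iff (M N : ModuleCat.{u} R) (n : ℕ) :
    ExtZero M N (n + 1) ↔ ∀ x : Abelian.Ext.{u} M N (n + 1), x = 0 := by
  obtain ⟨p⟩ := HasProjectiveResolution.out (Z := M)
  have hexact : ExtZero M N (n + 1) ↔ ∀ f : p.complex.X (n + 1) ⟶ N,
      p.complex.d (n + 2) (n + 1) ≫ f = 0 →
        ∃ g : p.complex.X n ⟶ N, p.complex.d (n + 1) n ≫ g = f := by
    rw [ExtZero, (p.isoExt (R := ℤ) (n + 1) N).isZero_iff,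
      ← HomologicalComplex.exactAt_iff_isZero_homology,
      HomologicalComplex.exactAt_iff' _ n (n + 1) (n + 2) (by simp) (by simp),
      ShortComplex.moduleCat_exact_iff]
    rfl
  rw [hexact]
  constructor
  · intro h x
    obtain ⟨f, hf, rfl⟩ := p.extMk_surjective x (n + 2) rfl
    exact (p.extMk_eq_zero_iff f (n + 2) rfl hf n rfl).2 (h f hf)
  · intro h f hf
    exact (p.extMk_eq_zero_iff f (n + 2) rfl hf n rfl).1 (h _)

lemma extZero_iff (M N : ModuleCat.{u} R) {n : ℕ} (hn : 0 < n) :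
    ExtZero M N n ↔ ∀ x : Abelian.Ext.{u} M N n, x = 0 := by
  obtain ⟨n, rfl⟩ := Nat.exists_eq_succ_of_ne_zero hn.ne'
  exact extZero_succ_iff M N n

section LongExactSequence

variable {K X M : ModuleCat.{u} R} {f : K ⟶ X} {g : X ⟶ M} {n : ℕ}

lemma IsSES.extZero_covariant_middle (h : IsSES f g) (Y : ModuleCat.{u} R) (hn : 0 < n)
    (h₁ : ExtZero Y K n) (h₃ : ExtZero Y M n) : ExtZero Y X n := by
  obtain ⟨w, hS⟩ := h
  rw [extZero_iff _ _ hn] at *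
  intro x
  obtain ⟨y, rfl⟩ := Abelian.Ext.covariant_sequence_exact₂ Y hS x (h₃ _)
  simp [h₁ y]

lemma IsSES.extZero_covariant_right (h : IsSES f g) (Y : ModuleCat.{u} R) (hn : 0 < n)
    (h₂ : ExtZero Y X n) (h₁ : ExtZero Y K (n + 1)) : ExtZero Y M n := by
  obtain ⟨w, hS⟩ := h
  rw [extZero_iff _ _ (by lia)] at *
  intro x
  obtain ⟨y, rfl⟩ := Abelian.Ext.covariant_sequence_exact₃ Y hS x rfl (h₁ _)
  simp [h₂ y]

lemma IsSES.extZero_contravariant_left (h : IsSES f g) (Y : ModuleCat.{u} R) (hn : 0 < n)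
    (h₂ : ExtZero X Y n) (h₃ : ExtZero M Y (n + 1)) : ExtZero K Y n := by
  obtain ⟨w, hS⟩ := h
  rw [extZero_iff _ _ (by lia)] at *
  intro x
  obtain ⟨y, rfl⟩ := Abelian.Ext.contravariant_sequence_exact₁ hS Y x (add_comm 1 n) (h₃ _)
  simp [h₂ y]

lemma IsSES.extZero_contravariant_right (h : IsSES f g) (Y : ModuleCat.{u} R) (hn : 0 < n)
    (h₁ : ExtZero K Y n) (h₂ : ExtZero X Y (n + 1)) : ExtZero M Y (n + 1) := by
  obtain ⟨w, hS⟩ := h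
  rw [extZero_iff _ _ (by lia)] at *
  intro x
  obtain ⟨y, rfl⟩ := Abelian.Ext.contravariant_sequence_exact₃ hS Y x (h₂ _) (add_comm 1 n)
  simp [h₁ y]

end LongExactSequence

lemma rpd_le_iff (𝒳 : Set (ModuleCat.{u} R)) (M : ModuleCat.{u} R) (n : ℕ∞) :
    rpd 𝒳 M ≤ n ↔ ∀ j : ℕ, n < (j : ℕ∞) → ∀ X ∈ 𝒳, ExtZero M X j := by
  refine ⟨fun h j hj => ?_, fun h => sInf_le h⟩
  have hmem : rpd 𝒳 M ∈ {n : ℕ∞ | ∀ j : ℕ, n < (j : ℕ∞) → ∀ X ∈ 𝒳, ExtZero M X j} :=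
    csInf_mem ⟨⊤, fun j hj => absurd hj (by simp)⟩
  exact hmem j (h.trans_lt hj)

lemma pd_le_natCast_iff (M : ModuleCat.{u} R) (n : ℕ) :
    pd M ≤ n ↔ ∀ j : ℕ, n < j → ∀ X, ExtZero M X j := by
  simp [pd, rpd_le_iff]

lemma HasResLen.mono {𝒳 𝒴 : Set (ModuleCat.{u} R)} (h𝒳 : 𝒳 ⊆ 𝒴) {n : ℕ} :
    ∀ {M : ModuleCat.{u} R}, HasResLen 𝒳 n M → HasResLen 𝒴 n M := by
  induction n with
  | zero => exact fun hM => h𝒳 hM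
  | succ n ih =>
    rintro M ⟨K, X, f, g, hX, hfg, hK⟩
    exact ⟨K, X, f, g, h𝒳 hX, hfg, ih hK⟩

lemma HasResLen.pd_le {𝒳 : Set (ModuleCat.{u} R)} {d : ℕ} (h𝒳 : ∀ X ∈ 𝒳, pd X ≤ d) {n : ℕ} :
    ∀ {M : ModuleCat.{u} R}, HasResLen 𝒳 n M → pd M ≤ (d + n : ℕ) := by
  induction n with
  | zero => exact fun hM => h𝒳 _ hM
  | succ n ih =>
    rintro M ⟨K, X, f, g, hX, hfg, hK⟩
    rw [pd_le_natCast_iff]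
    intro j hj Y
    obtain ⟨j, rfl⟩ := Nat.exists_eq_succ_of_ne_zero (by lia : j ≠ 0)
    exact hfg.extZero_contravariant_right Y (by lia)
      ((pd_le_natCast_iff _ _).1 (ih hK) j (by lia) Y)
      ((pd_le_natCast_iff _ _).1 (h𝒳 X hX) (j + 1) (by lia) Y)

section CotorsionPair

variable {𝒜 ℬ : Set (ModuleCat.{u} R)}

lemma pd_le_rpdClass (hcomp : IsComplete 𝒜 ℬ) (hher : IsHereditary 𝒜 ℬ)
    {A : ModuleCat.{u} R} (hA : A ∈ 𝒜) : pd A ≤ rpdClass 𝒜 𝒜 := by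
  refine (rpd_le_iff _ _ _).2 fun j hj X _ => ?_
  obtain ⟨B, A', f, g, hB, hA', hfg⟩ := (hcomp X).1
  have hle : rpd 𝒜 A ≤ rpdClass 𝒜 𝒜 := le_iSup (fun Y : 𝒜 => rpd 𝒜 Y) ⟨A, hA⟩
  have hj0 : 0 < j := by exact_mod_cast zero_le.trans_lt hj
  exact hfg.extZero_covariant_right A hj0 ((rpd_le_iff _ _ _).1 hle j hj A' hA')
    (hher (j + 1) (by lia) A hA B hB)

lemma IsHereditary.mem_right_of_hasResLen (hcp : IsCotorsionPair 𝒜 ℬ) (hher : IsHereditary 𝒜 ℬ)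
    {n : ℕ} : ∀ {M : ModuleCat.{u} R}, HasResLen ℬ n M → M ∈ ℬ := by
  induction n with
  | zero => exact fun hM => hM
  | succ n ih =>
    rintro M ⟨K, X, f, g, hX, hfg, hK⟩
    exact (hcp.2 M).2 fun A hA => hfg.extZero_covariant_right A one_pos
      (hher 1 le_rfl A hA X hX) (hher 2 one_le_two A hA K (ih hK))

lemma hasResLen_kernel_of_extZero (hcp : IsCotorsionPair 𝒜 ℬ) (hcomp : IsComplete 𝒜 ℬ)
    (hher : IsHereditary 𝒜 ℬ) {n : ℕ} : ∀ {M : ModuleCat.{u} R}, M ∈ ℬ →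
      (∀ j : ℕ, n < j → ∀ B ∈ ℬ, ExtZero M B j) → HasResLen (𝒜 ∩ ℬ) n M := by
  induction n with
  | zero => exact fun hM h => ⟨(hcp.1 _).2 (h 1 one_pos), hM⟩
  | succ n ih =>
    intro M hM h
    obtain ⟨K, X, f, g, hK, hX, hfg⟩ := (hcomp M).1
    have hXB : X ∈ ℬ := (hcp.2 X).2 fun A hA => hfg.extZero_covariant_middle A one_pos
      (hher 1 le_rfl A hA K hK) (hher 1 le_rfl A hA M hM)
    refine ⟨K, X, f, g, ⟨hX, hXB⟩, hfg, ih hK fun j hj B hB => ?_⟩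
    exact hfg.extZero_contravariant_left B (by lia) (hher j (by lia) X hX B hB)
      (h (j + 1) (by lia) B hB)

end CotorsionPair

/-- Proposition 4.1(c),(d): `pd M ≤ pd_𝒜(𝒜) + resdim_𝒜(M)` for `M ∈ 𝒫`, and
`𝒫 ∩ ℬ = ω^∧`. -/
theorem stmt16 {R : Type u} [Ring R] (𝒜 ℬ ω : Set (ModuleCat.{u} R))
    (hcp : IsCotorsionPair 𝒜 ℬ) (hcomp : IsComplete 𝒜 ℬ) (hher : IsHereditary 𝒜 ℬ)
    (hω : ω = 𝒜 ∩ ℬ) (hpd : rpdClass 𝒜 𝒜 < ⊤) :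
    (∀ M ∈ P R, pd M ≤ rpdClass 𝒜 𝒜 + resdim 𝒜 M) ∧
    P R ∩ ℬ = resClosure ω := by
  obtain ⟨d, hd⟩ := ENat.ne_top_iff_exists.1 hpd.ne
  have hA : ∀ A ∈ 𝒜, pd A ≤ d := fun A hA => hd ▸ pd_le_rpdClass hcomp hher hA
  subst hω
  refine ⟨fun M _ => ?_, Set.ext fun M => ⟨?_, ?_⟩⟩
  · rw [← hd, resdim, ENat.add_iInf]
    exact le_iInf fun n => by simpa using HasResLen.pd_le hA n.2
  · rintro ⟨hM, hMB⟩
    obtain ⟨n, hn⟩ := ENat.ne_top_iff_exists.1 (ne_of_lt hM)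
    exact ⟨n, hasResLen_kernel_of_extZero hcp hcomp hher hMB fun j hj B _ =>
      (pd_le_natCast_iff M n).1 hn.ge j hj B⟩
  · rintro ⟨n, hn⟩
    exact ⟨(HasResLen.pd_le hA (hn.mono Set.inter_subset_left)).trans_lt (ENat.natCast_lt_top _),
      hher.mem_right_of_hasResLen hcp (hn.mono Set.inter_subset_right)⟩

end CotorsionDim
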